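/- Let p, q ≥ 3 be integers. Then for every ε > 0 there exists b₀ > 0 such that for all b ∈ (0, b₀), every t ≥ 0 with R_b(t) = 0 satisfies |b·f_C'(t) − 1| < ε. (In particular, writing f_{b,C} = b·f_C and t_b for the smallest positive zero of R_b when it exists, f_{b,C}'(t_b) → 1 as b → 0.) -/

import Mathlib

open Set Filter

noncomputable section

/-- `h` is a smooth solution on `[0,∞)` of the ODE `h' = exp (-h^2/2)` with the
initial value `h 0 = √(-2 log (min λ (1/2)))`.  Derivatives on `[0,∞)` are taken
as derivatives within the set `Ici 0`. -/
def IsH0Sol (lam : ℝ) (h : ℝ → ℝ) : Prop :=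
  ContDiffOn ℝ (⊤ : ℕ∞) h (Ici 0) ∧
  (∀ t ∈ Ici (0:ℝ), derivWithin h (Ici 0) t = Real.exp (-(h t ^ 2) / 2)) ∧
  h 0 = Real.sqrt (-2 * Real.log (min lam (1/2)))

/-- `f` is a smooth solution on `[0,∞)` of the linear ODE
`f'' = C * exp (-h^2) * f` with `f 0 = 1` and `f' 0 = 0`. -/
def IsFCSol (C : ℝ) (h f : ℝ → ℝ) : Prop :=
  ContDiffOn ℝ (⊤ : ℕ∞) f (Ici 0) ∧
  (∀ t ∈ Ici (0:ℝ),
      derivWithin (derivWithin f (Ici 0)) (Ici 0) t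
        = C * Real.exp (-(h t ^ 2)) * f t) ∧
  f 0 = 1 ∧ derivWithin f (Ici 0) 0 = 0

theorem monotoneOn_Ici_of_hasDerivWithinAt_nonneg {a : ℝ} {g g' : ℝ → ℝ}
    (hg : ∀ t ∈ Ici a, HasDerivWithinAt g (g' t) (Ici a) t)
    (hg' : ∀ t ∈ Ici a, 0 ≤ g' t) : MonotoneOn g (Ici a) :=
  monotoneOn_of_hasDerivWithinAt_nonneg (convex_Ici a)
    (fun t ht => (hg t ht).continuousWithinAt)
    (fun t ht => (hg t (interior_subset ht)).mono interior_subset)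
    (fun t ht => hg' t (interior_subset ht))

namespace IsH0Sol

variable {lam : ℝ} {h : ℝ → ℝ}

theorem hasDerivWithinAt (hh : IsH0Sol lam h) {t : ℝ} (ht : t ∈ Ici (0:ℝ)) :
    HasDerivWithinAt h (Real.exp (-(h t ^ 2) / 2)) (Ici 0) t := by
  have hd := ((hh.1.differentiableOn (by simp)) t ht).hasDerivWithinAt
  rwa [hh.2.1 t ht] at hd

theorem zero_pos (hh : IsH0Sol lam h) (hlam : 0 < lam) : 0 < h 0 := by
  rw [hh.2.2, Real.sqrt_pos]
  have hlog : Real.log (min lam (1/2)) < 0 :=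
    Real.log_neg (lt_min hlam (by norm_num)) (by
      have := min_le_right lam (1/2)
      linarith)
  linarith

theorem monotoneOn (hh : IsH0Sol lam h) : MonotoneOn h (Ici 0) :=
  monotoneOn_Ici_of_hasDerivWithinAt_nonneg (fun _ ht => hh.hasDerivWithinAt ht)
    (fun _ _ => (Real.exp_pos _).le)

theorem zero_le_apply (hh : IsH0Sol lam h) {t : ℝ} (ht : 0 ≤ t) : h 0 ≤ h t :=
  hh.monotoneOn self_mem_Ici ht ht

theorem hasDerivWithinAt_exp (hh : IsH0Sol lam h) {t : ℝ} (ht : t ∈ Ici (0:ℝ)) :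
    HasDerivWithinAt (fun s => Real.exp (h s ^ 2 / 2)) (h t) (Ici 0) t := by
  have hd := (((hh.hasDerivWithinAt ht).pow 2).div_const 2).exp
  refine hd.congr_deriv ?_
  have he : Real.exp (h t ^ 2 / 2) * Real.exp (-(h t ^ 2) / 2) = 1 := by
    rw [← Real.exp_add, neg_div, add_neg_cancel, Real.exp_zero]
  simp only [Pi.pow_apply]
  push_cast
  linear_combination h t * he

theorem mul_sub_le_exp (hh : IsH0Sol lam h) {M T t : ℝ} (hT : 0 ≤ T) (hM : M ≤ h T)
    (hTt : T ≤ t) : M * (t - T) ≤ Real.exp (h t ^ 2 / 2) := by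
  have hmono : MonotoneOn (fun s => Real.exp (h s ^ 2 / 2) - M * s) (Ici T) := by
    refine monotoneOn_Ici_of_hasDerivWithinAt_nonneg (g' := fun s => h s - M) ?_ ?_
    · intro s hs
      refine ((hh.hasDerivWithinAt_exp (hT.trans hs)).mono (Ici_subset_Ici.2 hT)).sub ?_
      simpa using ((hasDerivAt_id s).const_mul M).hasDerivWithinAt
    · intro s hs
      have := hh.monotoneOn hT (hT.trans hs) hs
      linarith
  have := hmono self_mem_Ici hTt hTt
  have := Real.exp_pos (h T ^ 2 / 2)
  simp only at *
  linarith

theorem exists_le_apply (hh : IsH0Sol lam h) (hlam : 0 < lam) (M : ℝ) :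
    ∃ T, 0 ≤ T ∧ M ≤ h T := by
  have h0 := hh.zero_pos hlam
  have hT : 0 ≤ Real.exp (M ^ 2 / 2) / h 0 := by positivity
  refine ⟨_, hT, ?_⟩
  have hle := hh.mul_sub_le_exp le_rfl le_rfl hT
  rw [sub_zero, mul_div_cancel₀ _ h0.ne', Real.exp_le_exp] at hle
  exact le_of_sq_le_sq (by linarith) (h0.le.trans (hh.zero_le_apply hT))

theorem exists_forall_mul_exp_le (hh : IsH0Sol lam h) (hlam : 0 < lam) {δ : ℝ} (hδ : 0 < δ) :
    ∃ T, 0 ≤ T ∧ ∀ t, T ≤ t → t * Real.exp (-(h t ^ 2) / 2) ≤ δ := by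
  obtain ⟨T, hT, hM⟩ := hh.exists_le_apply hlam (2 / δ)
  refine ⟨2 * T, by linarith, fun t ht => ?_⟩
  have hle := hh.mul_sub_le_exp hT hM (by linarith : T ≤ t)
  rw [neg_div, Real.exp_neg, ← div_eq_mul_inv, div_le_iff₀ (Real.exp_pos _)]
  have hmul := mul_le_mul_of_nonneg_left hle hδ.le
  have heq : δ * (2 / δ * (t - T)) = 2 * (t - T) := by field_simp
  linarith

end IsH0Sol

namespace IsFCSol

variable {C : ℝ} {h f : ℝ → ℝ}

theorem hasDerivWithinAt (hf : IsFCSol C h f) {t : ℝ} (ht : t ∈ Ici (0:ℝ)) :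
    HasDerivWithinAt f (derivWithin f (Ici 0) t) (Ici 0) t :=
  ((hf.1.differentiableOn (by simp)) t ht).hasDerivWithinAt

theorem hasDerivWithinAt_derivWithin (hf : IsFCSol C h f) {t : ℝ} (ht : t ∈ Ici (0:ℝ)) :
    HasDerivWithinAt (derivWithin f (Ici 0)) (C * Real.exp (-(h t ^ 2)) * f t) (Ici 0) t := by
  have hc : ContDiffOn ℝ 1 (derivWithin f (Ici 0)) (Ici 0) :=
    hf.1.derivWithin (uniqueDiffOn_Ici 0) (WithTop.coe_le_coe.2 (le_top : (1 + 1 : ℕ∞) ≤ ⊤))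
  have hd := ((hc.differentiableOn (by simp)) t ht).hasDerivWithinAt
  rwa [hf.2.1 t ht] at hd

theorem mul_derivWithin_nonneg (hf : IsFCSol C h f) (hC : 0 ≤ C) {t : ℝ} (ht : 0 ≤ t) :
    0 ≤ f t * derivWithin f (Ici 0) t := by
  have hmono : MonotoneOn (fun s => f s * derivWithin f (Ici 0) s) (Ici 0) :=
    monotoneOn_Ici_of_hasDerivWithinAt_nonneg
      (g' := fun s => derivWithin f (Ici 0) s ^ 2 + C * Real.exp (-(h s ^ 2)) * f s ^ 2)
      (fun s hs => ((hf.hasDerivWithinAt hs).mul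
        (hf.hasDerivWithinAt_derivWithin hs)).congr_deriv (by ring))
      (fun s _ => by positivity)
  simpa [hf.2.2.2] using hmono self_mem_Ici ht ht

theorem one_le_sq (hf : IsFCSol C h f) (hC : 0 ≤ C) {t : ℝ} (ht : 0 ≤ t) : 1 ≤ f t ^ 2 := by
  have hmono : MonotoneOn (fun s => f s ^ 2) (Ici 0) :=
    monotoneOn_Ici_of_hasDerivWithinAt_nonneg
      (g' := fun s => 2 * (f s * derivWithin f (Ici 0) s))
      (fun s hs => ((hf.hasDerivWithinAt hs).pow 2).congr_deriv (by push_cast; ring))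
      (fun s hs => by
        have := hf.mul_derivWithin_nonneg hC hs
        linarith)
  simpa [hf.2.2.1] using hmono self_mem_Ici ht ht

theorem pos (hf : IsFCSol C h f) (hC : 0 ≤ C) {t : ℝ} (ht : 0 ≤ t) : 0 < f t := by
  by_contra! hneg
  have hcont : ContinuousOn f (Icc 0 t) := hf.1.continuousOn.mono Icc_subset_Ici_self
  obtain ⟨s, hs, hs0⟩ := intermediate_value_Icc' ht hcont ⟨hneg, by simp [hf.2.2.1]⟩
  have := hf.one_le_sq hC hs.1
  norm_num [hs0] at this

theorem derivWithin_nonneg (hf : IsFCSol C h f) (hC : 0 ≤ C) {t : ℝ} (ht : 0 ≤ t) :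
    0 ≤ derivWithin f (Ici 0) t :=
  nonneg_of_mul_nonneg_right (hf.mul_derivWithin_nonneg hC ht) (hf.pos hC ht)

theorem second_deriv_nonneg (hf : IsFCSol C h f) (hC : 0 ≤ C) {t : ℝ} (ht : 0 ≤ t) :
    0 ≤ C * Real.exp (-(h t ^ 2)) * f t := by
  have := hf.pos hC ht
  positivity

theorem monotoneOn_derivWithin (hf : IsFCSol C h f) (hC : 0 ≤ C) :
    MonotoneOn (derivWithin f (Ici 0)) (Ici 0) :=
  monotoneOn_Ici_of_hasDerivWithinAt_nonneg
    (fun _ ht => hf.hasDerivWithinAt_derivWithin ht)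
    (fun _ ht => hf.second_deriv_nonneg hC ht)

theorem le_one_add_mul_derivWithin (hf : IsFCSol C h f) (hC : 0 ≤ C) {t : ℝ} (ht : 0 ≤ t) :
    f t ≤ 1 + t * derivWithin f (Ici 0) t := by
  have hmono : MonotoneOn (fun s => s * derivWithin f (Ici 0) s - f s) (Ici 0) :=
    monotoneOn_Ici_of_hasDerivWithinAt_nonneg
      (g' := fun s => s * (C * Real.exp (-(h s ^ 2)) * f s))
      (fun s hs => (((hasDerivWithinAt_id s _).mul (hf.hasDerivWithinAt_derivWithin hs)).sub
        (hf.hasDerivWithinAt hs)).congr_deriv (by simp))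
      (fun s hs => mul_nonneg hs (hf.second_deriv_nonneg hC hs))
  have := hmono self_mem_Ici ht ht
  simp only [hf.2.2.1, zero_mul] at this
  linarith

/-- The product `h' * f` is bounded by an arbitrarily small multiple of `f'`, up to a constant. -/
theorem exists_exp_mul_le {lam : ℝ} (hf : IsFCSol C h f) (hC : 0 ≤ C) (hh : IsH0Sol lam h)
    (hlam : 0 < lam) {δ : ℝ} (hδ : 0 < δ) :
    ∃ K, 0 ≤ K ∧ ∀ t, 0 ≤ t →
      Real.exp (-(h t ^ 2) / 2) * f t ≤ δ * derivWithin f (Ici 0) t + K := by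
  obtain ⟨T, hT, hle⟩ := hh.exists_forall_mul_exp_le hlam hδ
  have hfT := hf.derivWithin_nonneg hC hT
  refine ⟨1 + T * derivWithin f (Ici 0) T, by positivity, fun t ht => ?_⟩
  have hft := hf.derivWithin_nonneg hC ht
  have hexp : Real.exp (-(h t ^ 2) / 2) ≤ 1 :=
    Real.exp_le_one_iff.2 (by linarith [sq_nonneg (h t)])
  have hf_le := hf.le_one_add_mul_derivWithin hC ht
  rcases le_total t T with htT | hTt
  · have hd := hf.monotoneOn_derivWithin hC ht hT htT
    have hprod : t * derivWithin f (Ici 0) t ≤ T * derivWithin f (Ici 0) T :=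
      mul_le_mul htT hd hft hT
    have := mul_le_mul_of_nonneg_right hexp (hf.pos hC ht).le
    have : 0 ≤ δ * derivWithin f (Ici 0) t := by positivity
    linarith
  · have h1 := mul_le_mul_of_nonneg_left hf_le (Real.exp_pos (-(h t ^ 2) / 2)).le
    have h2 := mul_le_mul_of_nonneg_right (hle t hTt) hft
    have : 0 ≤ T * derivWithin f (Ici 0) T := by positivity
    linarith

end IsFCSol

/-- If the curvature expression vanishes, `1 - (b f')²` is controlled by `b h' f`; here
`d = f'(t)`, `k = h'(t)`, `H = h(t)`, `F = f(t)`. -/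
theorem abs_mul_sub_one_le_of_curvature_eq_zero {C b d k H F H0 m n : ℝ}
    (hC : 0 ≤ C) (hC1 : C ≤ 1) (hb : 0 < b) (hd : 0 ≤ d) (hk : 0 ≤ k) (hF : 0 < F)
    (hH0 : 0 < H0) (hH : H0 ≤ H) (hm : 0 ≤ m) (hn : 1 ≤ n)
    (hR : -C * k ^ 2 + n * ((b ^ 2)⁻¹ - d ^ 2) / F ^ 2 - m * k * d / (H * F) = 0) :
    b * d ≤ 1 ∧ (b * k * F ≤ 1 → |b * d - 1| ≤ (1 + m / H0) * (b * k * F)) := by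
  have hHpos : 0 < H := hH0.trans_le hH
  have key : n * (1 - (b * d) ^ 2) = C * (b * k * F) ^ 2 + m * (b * d) * (b * k * F) / H := by
    field_simp at hR ⊢
    linear_combination hR
  set X := b * k * F
  have hX0 : 0 ≤ X := by positivity
  have hbd : 0 ≤ b * d := by positivity
  have hrhs : 0 ≤ n * (1 - (b * d) ^ 2) := by
    rw [key]
    positivity
  have hsq : 0 ≤ 1 - (b * d) ^ 2 := nonneg_of_mul_nonneg_right hrhs (by linarith)
  have hle1 : b * d ≤ 1 := by nlinarith
  refine ⟨hle1, fun hX1 => ?_⟩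
  have hfirst : C * X ^ 2 ≤ X := by nlinarith [mul_nonneg hX0 (sub_nonneg.2 hX1)]
  have hsecond : m * (b * d) * X / H ≤ m / H0 * X := by
    calc m * (b * d) * X / H ≤ m * 1 * X / H0 := by gcongr
      _ = m / H0 * X := by ring
  rw [abs_of_nonpos (by linarith)]
  nlinarith [mul_nonneg (sub_nonneg.2 hn) hsq, mul_nonneg hbd (sub_nonneg.2 hle1)]

/-- At zeros of `R_b = Ric(W,W)` the derivative `(b·f_C)' = b·f_C'` tends to `1`
as `b → 0`: for every `ε > 0` there is `b₀ > 0` such that for `0 < b < b₀` every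
`t ≥ 0` with `R b t = 0` satisfies `|b·f_C'(t) - 1| < ε`. -/
theorem stmt_19 (lam : ℝ) (hlam : 0 < lam) (h : ℝ → ℝ) (hh : IsH0Sol lam h)
    (C : ℝ) (hC : 0 < C) (hC' : C < 1) (f : ℝ → ℝ) (hf : IsFCSol C h f)
    (p q : ℕ) (hp : 3 ≤ p) (hq : 3 ≤ q)
    (h1 f1 : ℝ → ℝ)
    (hh1 : h1 = derivWithin h (Ici 0)) (hf1 : f1 = derivWithin f (Ici 0))
    (R : ℝ → ℝ → ℝ)
    (hR : ∀ b t, R b t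
      = -C * Real.exp (-(h t ^ 2))
        + ((q:ℝ) - 2) * ((b ^ 2)⁻¹ - f1 t ^ 2) / f t ^ 2
        - ((p:ℝ) - 1) * h1 t * f1 t / (h t * f t)) :
    ∀ ε > (0:ℝ), ∃ b₀ > (0:ℝ), ∀ b ∈ Ioo (0:ℝ) b₀,
      ∀ t ∈ Ici (0:ℝ), R b t = 0 → |b * f1 t - 1| < ε := by
  intro ε hε
  subst hh1 hf1
  have h0 := hh.zero_pos hlam
  have hp' : (3:ℝ) ≤ p := by exact_mod_cast hp
  have hq' : (3:ℝ) ≤ q := by exact_mod_cast hq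
  set A := 1 + ((p:ℝ) - 1) / h 0
  have hA : 0 < A := by
    have : 0 ≤ ((p:ℝ) - 1) / h 0 := div_nonneg (by linarith) h0.le
    linarith
  obtain ⟨δ, hδ, hδ_lt⟩ : ∃ δ > 0, δ < min (1 / 2) (ε / (2 * A)) := exists_between (by positivity)
  obtain ⟨K, hK, hKle⟩ := hf.exists_exp_mul_le hC.le hh hlam hδ
  refine ⟨δ / (K + 1), by positivity, fun b hb t ht hRt => ?_⟩
  have hbK : b * K ≤ δ := by
    have := (lt_div_iff₀ (by positivity)).1 hb.2
    linarith [hb.1]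
  rw [hR, hh.2.1 t ht, show Real.exp (-(h t ^ 2)) = Real.exp (-(h t ^ 2) / 2) ^ 2 by
    rw [← Real.exp_nat_mul]; congr 1; push_cast; ring] at hRt
  obtain ⟨hle1, hbound⟩ := abs_mul_sub_one_le_of_curvature_eq_zero hC.le hC'.le hb.1
    (hf.derivWithin_nonneg hC.le ht) (Real.exp_pos _).le (hf.pos hC.le ht) h0
    (hh.zero_le_apply ht) (by linarith) (by linarith) hRt
  have hX : b * Real.exp (-(h t ^ 2) / 2) * f t ≤ 2 * δ := by
    have hmul := mul_le_mul_of_nonneg_left (hKle t ht) hb.1.le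
    have := mul_le_mul_of_nonneg_left hle1 hδ.le
    linarith
  have hδ_half := hδ_lt.trans_le (min_le_left _ _)
  have hδ_eps := (lt_div_iff₀ (by positivity)).1 (hδ_lt.trans_le (min_le_right _ _))
  have hAX := mul_le_mul_of_nonneg_left hX hA.le
  linarith [hbound (by linarith)]
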